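/- For every forest transducer M there is a constant c ≥ 2 such that for every pair (f,g) ∈ ⟦M⟧, the height of the binary tree fcns(g) is at most c^(h+1), where h is the height of the binary tree fcns(f); that is, the height of the output of an FT, viewed as a binary tree via the first-child next-sibling encoding, is at most exponential in the height of the encoded input. -/

import Mathlib

set_option autoImplicit true
set_option maxHeartbeats 1000000

/-! ## XML forests (in first-child next-sibling style, also serving as binary XML trees) -/

/-- Node types: element, attribute, text nodes. -/
inductive NodeKind where
  | elem | attr | text
deriving DecidableEq, Repr

/-- Nonempty words over the universal alphabet `U` (= `Char`). -/
abbrev Word : Type := {w : List Char // w ≠ []}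

/-- A node label: a type together with a name (a nonempty word over `U`). -/
abbrev Label : Type := NodeKind × Word

/-- XML forests; `node l c r` is a tree with root label `l`, children forest `c`,
followed by the forest `r` of further trees of the sequence.  Under the
first-child next-sibling correspondence this type also represents binary XML
trees (with `eps` the ε-leaves and every labeled node binary), and the
encoding `fcns` is the identity of this representation. -/
inductive Forest where
  | eps : Forest
  | node : Label → Forest → Forest → Forest
deriving DecidableEq, Repr

namespace Forest

/-- Concatenation of forests. -/
def append : Forest → Forest → Forest
  | .eps, g => g
  | .node l c r, g => .node l c (append r g)

/-- The size of a forest = its number of nodes. -/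
def size : Forest → ℕ
  | .eps => 0
  | .node _ c r => 1 + c.size + r.size

/-- Height of a binary XML tree (length of the longest root-to-leaf path). -/
def height : Forest → ℕ
  | .eps => 0
  | .node _ c r => 1 + max c.height r.height

/-- All labels of the forest belong to `S`. -/
def labelsIn (S : Finset Label) : Forest → Prop
  | .eps => True
  | .node l c r => l ∈ S ∧ c.labelsIn S ∧ r.labelsIn S

end Forest

/-! ## Macro forest transducers -/

/-- Input variables: `x0` binds the current node together with the rest of the
stream, `x1` the children of the current node, `x2` the rest of the stream. -/
inductive XVar where
  | x0 | x1 | x2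
deriving DecidableEq, Repr

def XVar.sel : XVar → Forest → Forest → Forest → Forest
  | .x0, g0, _, _ => g0
  | .x1, _, g1, _ => g1
  | .x2, _, _, g2 => g2

/-- Right-hand sides of MFT rules: forests over `Σ ∪ Q ∪ {x0,x1,x2} ∪ Y`,
where a leaf is labeled by an input variable exactly if it is the first child of
a state-labeled node (constructor `call`), parameters occur only at leaves
(constructor `param`, with the remainder of the forest sequence), and `tnode`
is a `%t`-labeled node (only allowed in default rules). -/
inductive RHS (Q : Type) where
  | eps   : RHS Q
  | node  : Label → RHS Q → RHS Q → RHS Q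
  | tnode : RHS Q → RHS Q → RHS Q
  | param : ℕ → RHS Q → RHS Q
  | call  : Q → XVar → List (RHS Q) → RHS Q → RHS Q

namespace RHS

/-- Number of nodes of a right-hand side. -/
def size : RHS Q → ℕ
  | .eps => 0
  | .node _ c r => 1 + c.size + r.size
  | .tnode c r => 1 + c.size + r.size
  | .param _ r => 1 + r.size
  | .call _ _ args r => 1 + (args.attach.map (fun a => a.1.size)).sum + r.size
decreasing_by
  all_goals simp_wf
  all_goals try omega
  all_goals (have := List.sizeOf_lt_of_mem a.2; omega)


/-- Concatenation of right-hand-side forests. -/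
def append : RHS Q → RHS Q → RHS Q
  | .eps, t => t
  | .node l c r, t => .node l c (r.append t)
  | .tnode c r, t => .tnode c (r.append t)
  | .param j r, t => .param j (r.append t)
  | .call p x as r, t => .call p x as (r.append t)

mutual
/-- All calls in the right-hand side use only the input variable `x0`. -/
def varsOnly0 : RHS Q → Prop
  | .eps => True
  | .node _ c r => c.varsOnly0 ∧ r.varsOnly0
  | .tnode c r => c.varsOnly0 ∧ r.varsOnly0
  | .param _ r => r.varsOnly0
  | .call _ x args r => x = .x0 ∧ varsOnly0L args ∧ r.varsOnly0
def varsOnly0L : List (RHS Q) → Prop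
  | [] => True
  | a :: as => a.varsOnly0 ∧ varsOnly0L as
end

mutual
/-- No `%t`-labeled node occurs. -/
def noT : RHS Q → Prop
  | .eps => True
  | .node _ c r => c.noT ∧ r.noT
  | .tnode _ _ => False
  | .param _ r => r.noT
  | .call _ _ args r => noTL args ∧ r.noT
def noTL : List (RHS Q) → Prop
  | [] => True
  | a :: as => a.noT ∧ noTL as
end

mutual
/-- All labels of the right-hand side belong to `S`. -/
def labelsIn (S : Finset Label) : RHS Q → Prop
  | .eps => True
  | .node l c r => l ∈ S ∧ c.labelsIn S ∧ r.labelsIn S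
  | .tnode c r => c.labelsIn S ∧ r.labelsIn S
  | .param _ r => r.labelsIn S
  | .call _ _ args r => labelsInL S args ∧ r.labelsIn S
def labelsInL (S : Finset Label) : List (RHS Q) → Prop
  | [] => True
  | a :: as => a.labelsIn S ∧ labelsInL S as
end

mutual
/-- Ranks are respected: every state call `q` carries exactly `prm q` parameter
arguments and the parameters used are among `y₁,…,y_m`. -/
def arityOK (prm : Q → ℕ) (m : ℕ) : RHS Q → Prop
  | .eps => True
  | .node _ c r => c.arityOK prm m ∧ r.arityOK prm m
  | .tnode c r => c.arityOK prm m ∧ r.arityOK prm m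
  | .param j r => j < m ∧ r.arityOK prm m
  | .call q _ args r => args.length = prm q ∧ arityOKL prm m args ∧ r.arityOK prm m
def arityOKL (prm : Q → ℕ) (m : ℕ) : List (RHS Q) → Prop
  | [] => True
  | a :: as => a.arityOK prm m ∧ arityOKL prm m as
end

mutual
/-- No stay move: no call `q'(x₀)` occurs. -/
def noStay : RHS Q → Prop
  | .eps => True
  | .node _ c r => c.noStay ∧ r.noStay
  | .tnode c r => c.noStay ∧ r.noStay
  | .param _ r => r.noStay
  | .call _ x args r => x ≠ .x0 ∧ noStayL args ∧ r.noStay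
def noStayL : List (RHS Q) → Prop
  | [] => True
  | a :: as => a.noStay ∧ noStayL as
end

mutual
/-- The right-hand side is a **tree** in which every labeled node is binary
(reading `node l c r` as the binary node `l(c,r)`); parameters and state calls
occur as leaves of this tree (empty continuation). -/
def isTree : RHS Q → Prop
  | .eps => True
  | .node _ c r => c.isTree ∧ r.isTree
  | .tnode c r => c.isTree ∧ r.isTree
  | .param _ r => r = .eps
  | .call _ _ args r => isTreeL args ∧ r = .eps
def isTreeL : List (RHS Q) → Prop
  | [] => True
  | a :: as => a.isTree ∧ isTreeL as
end

end RHS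

/-- A macro forest transducer (MFT) over the finite set `sig ⊆ U⁺` of symbols:
a finite ranked set `Q` of states (state `q` has `prm q` accumulating
parameters, i.e. rank `prm q + 1`), an initial state `q0` of rank 1, and for
every state at most one `(q,σ)`-rule per symbol `σ ∈ sig`, exactly one ε-rule
and exactly one default rule. -/
structure MFT where
  Q : Type
  [fintypeQ : Fintype Q]
  [deceqQ : DecidableEq Q]
  prm : Q → ℕ
  q0 : Q
  sig : Finset Label
  ruleSym : Q → Label → Option (RHS Q)
  ruleEps : Q → RHS Q
  ruleDef : Q → RHS Q

attribute [instance] MFT.fintypeQ MFT.deceqQ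

/-- Well-formedness of an MFT, as required by the definition: the initial state
has rank 1; `(q,σ)`-rules only for `σ ∈ sig`; `(q,σ)`-rules contain no `%t`;
ε-rules contain no `%t` and use only the input variable `x0`; all labels in
right-hand sides are symbols of `sig`; all rules respect the ranks of states. -/
def MFT.WF (M : MFT) : Prop :=
  M.prm M.q0 = 0 ∧
  (∀ q a, a ∉ M.sig → M.ruleSym q a = none) ∧
  (∀ q a r, M.ruleSym q a = some r →
      r.noT ∧ r.labelsIn M.sig ∧ r.arityOK M.prm (M.prm q)) ∧
  (∀ q : M.Q, (M.ruleEps q).noT ∧ (M.ruleEps q).varsOnly0 ∧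
      (M.ruleEps q).labelsIn M.sig ∧ (M.ruleEps q).arityOK M.prm (M.prm q)) ∧
  (∀ q : M.Q, (M.ruleDef q).labelsIn M.sig ∧ (M.ruleDef q).arityOK M.prm (M.prm q))

mutual
/-- Big-step semantics of states: `Eval M q g ys out` means
`⟦q⟧(g, ys) = out`: the unique applicable rule of `q` on input `g` is chosen
(the ε-rule if `g = ε`, the `(q,σ)`-rule if `g = σ(g₁)g₂` and it exists,
otherwise the default rule) and its right-hand side evaluated. -/
inductive Eval (M : MFT) : M.Q → Forest → List Forest → Forest → Prop where
  | eps : ∀ (q : M.Q) (ys : List Forest) (out : Forest),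
      EvalR M (M.ruleEps q) .eps .eps .eps none ys out →
      Eval M q .eps ys out
  | sym : ∀ (q : M.Q) (l : Label) (c r : Forest) (rh : RHS M.Q) ys out,
      M.ruleSym q l = some rh →
      EvalR M rh (.node l c r) c r (some l) ys out →
      Eval M q (.node l c r) ys out
  | dflt : ∀ (q : M.Q) (l : Label) (c r : Forest) ys out,
      M.ruleSym q l = none →
      EvalR M (M.ruleDef q) (.node l c r) c r (some l) ys out →
      Eval M q (.node l c r) ys out

/-- Evaluation of right-hand sides: `EvalR M rh g0 g1 g2 lab ys out`; here `g0`
is bound to `x0`, `g1` to `x1`, `g2` to `x2`, `lab` is the label of the current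
node (for `%t`-nodes), and `ys` are the values of the parameters. -/
inductive EvalR (M : MFT) : RHS M.Q → Forest → Forest → Forest → Option Label →
    List Forest → Forest → Prop where
  | eps : ∀ g0 g1 g2 lab ys, EvalR M .eps g0 g1 g2 lab ys .eps
  | node : ∀ (l : Label) c r g0 g1 g2 lab ys oc orr,
      EvalR M c g0 g1 g2 lab ys oc → EvalR M r g0 g1 g2 lab ys orr →
      EvalR M (.node l c r) g0 g1 g2 lab ys (.node l oc orr)
  | tnode : ∀ (l : Label) c r g0 g1 g2 ys oc orr,
      EvalR M c g0 g1 g2 (some l) ys oc → EvalR M r g0 g1 g2 (some l) ys orr →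
      EvalR M (.tnode c r) g0 g1 g2 (some l) ys (.node l oc orr)
  | param : ∀ (j : ℕ) r g0 g1 g2 lab ys orr,
      EvalR M r g0 g1 g2 lab ys orr →
      EvalR M (.param j r) g0 g1 g2 lab ys ((ys.getD j .eps).append orr)
  | call : ∀ (p : M.Q) (x : XVar) args cont g0 g1 g2 lab ys vs oq orr,
      EvalL M args g0 g1 g2 lab ys vs →
      Eval M p (x.sel g0 g1 g2) vs oq →
      EvalR M cont g0 g1 g2 lab ys orr →
      EvalR M (.call p x args cont) g0 g1 g2 lab ys (oq.append orr)

/-- Pointwise evaluation of the parameter-argument list of a state call. -/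
inductive EvalL (M : MFT) : List (RHS M.Q) → Forest → Forest → Forest →
    Option Label → List Forest → List Forest → Prop where
  | nil : ∀ g0 g1 g2 lab ys, EvalL M [] g0 g1 g2 lab ys []
  | cons : ∀ a as g0 g1 g2 lab ys v vs,
      EvalR M a g0 g1 g2 lab ys v → EvalL M as g0 g1 g2 lab ys vs →
      EvalL M (a :: as) g0 g1 g2 lab ys (v :: vs)
end

/-- The translation realized by `M`: `⟦M⟧(f) = ⟦q₀⟧(f)` (as a binary relation;
for terminating MFTs this relation is a total function). -/
def MFT.Sem (M : MFT) : Forest → Forest → Prop :=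
  fun f g => Eval M M.q0 f [] g

/-- `M` is terminating: every state on every input with every parameter
assignment produces exactly one output. -/
def MFT.Terminating (M : MFT) : Prop :=
  ∀ (q : M.Q) (f : Forest) (ys : List Forest), ∃! out, Eval M q f ys out

/-- Size of a transducer: `|sig|` plus the sum of the sizes of all left-hand
sides and right-hand sides of its rules. -/
def MFT.size (M : MFT) : ℕ :=
  M.sig.card +
    ∑ q : M.Q, ((M.prm q + 2) + (M.ruleEps q).size
      + ((M.prm q + 4) + (M.ruleDef q).size)
      + ∑ a ∈ M.sig, ((M.ruleSym q a).elim 0 fun r => (M.prm q + 4) + r.size))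

/-- A forest transducer (FT): an MFT all of whose states have rank 1
(no accumulating parameters). -/
def MFT.IsFT (M : MFT) : Prop := ∀ q : M.Q, M.prm q = 0

/-- A macro tree transducer (MTT): an MFT whose rule right-hand sides are trees
in which every `Σ∪{%t}`-labeled node is binary. -/
def MFT.IsMTT (M : MFT) : Prop :=
  (∀ q a r, M.ruleSym q a = some r → r.isTree) ∧
  (∀ q : M.Q, (M.ruleEps q).isTree ∧ (M.ruleDef q).isTree)

/-- A top-down tree transducer (TT): an FT that is an MTT. -/
def MFT.IsTT (M : MFT) : Prop := M.IsFT ∧ M.IsMTT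

/-- `M` contains no stay moves. -/
def MFT.NoStay (M : MFT) : Prop :=
  (∀ q a r, M.ruleSym q a = some r → r.noStay) ∧
  (∀ q : M.Q, (M.ruleEps q).noStay ∧ (M.ruleDef q).noStay)

/-- Composition of translations (apply `T1` first, then `T2`). -/
def TransComp (T1 T2 : Forest → Forest → Prop) : Forest → Forest → Prop :=
  fun f g => ∃ h, T1 f h ∧ T2 h g

/-! ## Classes of (binary) tree translations -/

/-- Under the first-child next-sibling representation used here, forests are
represented by their binary XML trees, so the encoding `fcns`
(`fcns(ε)=ε`, `fcns(σ(f₁)f₂)=σ(fcns f₁, fcns f₂)`) is realized by the identity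
on the representation. -/
def fcns : Forest → Forest
  | .eps => .eps
  | .node l c r => .node l (fcns c) (fcns r)

/-- The class of binary tree translations of all (terminating) MFTs. -/
def MFTclass : Set (Forest → Forest → Prop) :=
  {T | ∃ M : MFT, M.WF ∧ M.Terminating ∧ T = fun f g => M.Sem f g}

/-- The class of tree translations of all (terminating) MTTs. -/
def MTTclass : Set (Forest → Forest → Prop) :=
  {T | ∃ M : MFT, M.WF ∧ M.Terminating ∧ M.IsMTT ∧ T = fun f g => M.Sem f g}

/-- The class of binary tree translations of all (terminating) FTs. -/
def FTclass : Set (Forest → Forest → Prop) :=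
  {T | ∃ M : MFT, M.WF ∧ M.Terminating ∧ M.IsFT ∧ T = fun f g => M.Sem f g}

/-- The class of tree translations of all (terminating) TTs. -/
def TTclass : Set (Forest → Forest → Prop) :=
  {T | ∃ M : MFT, M.WF ∧ M.Terminating ∧ M.IsTT ∧ T = fun f g => M.Sem f g}

/-- The evaluation mapping `eval_Σ` with distinguished binary symbol `@` (here
`d`): it interprets `d`-labeled binary nodes as forest concatenation and acts
as the identity on all other labels. -/
def evalMap (d : Label) : Forest → Forest
  | .eps => .eps
  | .node l c r =>
      if l = d then (evalMap d c).append (evalMap d r)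
      else .node l (evalMap d c) (evalMap d r)

/-- The translation (graph) of the evaluation mapping `eval` with
distinguished symbol `d`. -/
def evalTrans (d : Label) : Forest → Forest → Prop := fun f g => g = evalMap d f

/-- The class `EVAL` of all evaluation mappings. -/
def EVALclass : Set (Forest → Forest → Prop) :=
  {T | ∃ d : Label, T = evalTrans d}

/-- Composition of classes of translations:
`F ∘ G = { f ∘ g : f ∈ F, g ∈ G }` (apply a member of `F` first). -/
def classComp (F G : Set (Forest → Forest → Prop)) : Set (Forest → Forest → Prop) :=
  {T | ∃ t1 ∈ F, ∃ t2 ∈ G, T = TransComp t1 t2}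

namespace Forest

/-- The forest of children of the first root. -/
def children : Forest → Forest
  | .eps => .eps
  | .node _ c _ => c

/-- The forest following the first tree. -/
def next : Forest → Forest
  | .eps => .eps
  | .node _ _ r => r

theorem height_append_le (f g : Forest) : (f.append g).height ≤ f.height + g.height := by
  induction f with
  | eps => simp [append]
  | node l c r _ ihr =>
    simp only [append, height]
    omega

end Forest

theorem fcns_eq_self (f : Forest) : fcns f = f := by
  induction f with
  | eps => rfl
  | node l c r ihc ihr => rw [fcns, ihc, ihr]

/-- `HasCall r p x`: the call `p(x, …)` occurs in `r` outside the arguments of other calls. -/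
inductive RHS.HasCall {Q : Type} : RHS Q → Q → XVar → Prop where
  | node_left {l c r p x} : HasCall c p x → HasCall (.node l c r) p x
  | node_right {l c r p x} : HasCall r p x → HasCall (.node l c r) p x
  | tnode_left {c r p x} : HasCall c p x → HasCall (.tnode c r) p x
  | tnode_right {c r p x} : HasCall r p x → HasCall (.tnode c r) p x
  | param {j r p x} : HasCall r p x → HasCall (.param j r) p x
  | call_self {p x args r} : HasCall (.call p x args r) p x
  | call_right {q y args r p x} : HasCall r p x → HasCall (.call q y args r) p x

theorem RHS.HasCall.eq_x0 {Q : Type} {rh : RHS Q} {p : Q} {x : XVar} (h : rh.HasCall p x)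
    (h0 : rh.varsOnly0) : x = .x0 := by
  induction h <;> simp_all [RHS.varsOnly0]

namespace MFT

/-- The right-hand side of the rule applicable in state `q` on input `f`. -/
def body (M : MFT) (q : M.Q) : Forest → RHS M.Q
  | .eps => M.ruleEps q
  | .node l _ _ => (M.ruleSym q l).getD (M.ruleDef q)

/-- `M.Stay f p q`: on input `f`, the rule for `q` contains the stay move `p(x₀)`. -/
def Stay (M : MFT) (f : Forest) (p q : M.Q) : Prop := (M.body q f).HasCall p .x0

theorem body_arityOK {M : MFT} (hW : M.WF) (hF : M.IsFT) (q : M.Q) (f : Forest) :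
    (M.body q f).arityOK M.prm 0 := by
  obtain ⟨-, -, hs, he, hd⟩ := hW
  rw [← hF q]
  cases f with
  | eps => exact (he q).2.2.2
  | node l c r =>
    rw [body]
    cases h : M.ruleSym q l with
    | none => exact (hd q).2
    | some rh => exact (hs q l rh h).2.2

theorem body_size_le {M : MFT} (hW : M.WF) (q : M.Q) (f : Forest) :
    (M.body q f).size ≤ M.size := by
  have hq := Finset.single_le_sum (f := fun q : M.Q => (M.prm q + 2) + (M.ruleEps q).size
      + ((M.prm q + 4) + (M.ruleDef q).size)
      + ∑ a ∈ M.sig, ((M.ruleSym q a).elim 0 fun r => (M.prm q + 4) + r.size))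
      (fun _ _ => Nat.zero_le _) (Finset.mem_univ q)
  rw [MFT.size]
  cases f with
  | eps => simp only [body]; omega
  | node l c r =>
    rw [body]
    cases h : M.ruleSym q l with
    | none => simp only [Option.getD_none]; omega
    | some rh =>
      have hl : l ∈ M.sig := by
        by_contra hl
        simp [hW.2.1 q l hl] at h
      have := Finset.single_le_sum
        (f := fun a => (M.ruleSym q a).elim 0 fun r => (M.prm q + 4) + r.size)
        (fun _ _ => Nat.zero_le _) hl
      simp only [h, Option.elim_some] at this
      simp only [Option.getD_some]
      omega

theorem two_le_size (M : MFT) : 2 ≤ M.size := by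
  have := Finset.single_le_sum (f := fun q : M.Q => (M.prm q + 2) + (M.ruleEps q).size
      + ((M.prm q + 4) + (M.ruleDef q).size)
      + ∑ a ∈ M.sig, ((M.ruleSym q a).elim 0 fun r => (M.prm q + 4) + r.size))
      (fun _ _ => Nat.zero_le _) (Finset.mem_univ M.q0)
  rw [MFT.size]
  omega

end MFT

theorem Eval.exists_evalR_body {M : MFT} {q : M.Q} {f : Forest} {ys : List Forest} {out : Forest}
    (h : Eval M q f ys out) :
    ∃ lab, EvalR M (M.body q f) f f.children f.next lab ys out := by
  cases h with
  | eps _ _ _ h => exact ⟨_, h⟩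
  | sym _ l c r rh _ _ hr h =>
    exact ⟨some l, by simpa [MFT.body, hr, Forest.children, Forest.next] using h⟩
  | dflt _ l c r _ _ hr h =>
    exact ⟨some l, by simpa [MFT.body, hr, Forest.children, Forest.next] using h⟩

theorem Eval.acc_stay {M : MFT} {q : M.Q} {f : Forest} {ys : List Forest} {out : Forest}
    (h : Eval M q f ys out) : Acc (M.Stay f) q := by
  refine Eval.rec (motive_1 := fun q f _ _ _ => Acc (M.Stay f) q)
    (motive_2 := fun rh g0 _ _ _ _ _ _ => ∀ p, rh.HasCall p .x0 → Acc (M.Stay g0) p)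
    (motive_3 := fun _ _ _ _ _ _ _ _ => True)
    ?_ ?_ ?_ ?_ ?_ ?_ ?_ ?_ ?_ ?_ h
  · exact fun q ys out _ ih => ⟨q, ih⟩
  · refine fun q l c r rh ys out hr _ ih => ⟨q, fun p hp => ih p ?_⟩
    simpa [MFT.Stay, MFT.body, hr] using hp
  · refine fun q l c r ys out hr _ ih => ⟨q, fun p hp => ih p ?_⟩
    simpa [MFT.Stay, MFT.body, hr] using hp
  · intro _ _ _ _ _ p hp
    cases hp
  · intro _ _ _ _ _ _ _ _ _ _ _ _ ihc ihr p hp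
    cases hp with
    | node_left hp => exact ihc p hp
    | node_right hp => exact ihr p hp
  · intro _ _ _ _ _ _ _ _ _ _ _ ihc ihr p hp
    cases hp with
    | tnode_left hp => exact ihc p hp
    | tnode_right hp => exact ihr p hp
  · intro _ _ _ _ _ _ _ _ _ ih p hp
    cases hp with
    | param hp => exact ih p hp
  · intro _ _ _ _ _ _ _ _ _ _ _ _ _ _ _ _ ihq ihr p hp
    cases hp with
    | call_self => exact ihq
    | call_right hp => exact ihr p hp
  · intros; trivial
  · intros; trivial

/-- If the outputs of all calls of a parameterless right-hand side have height at most `B`,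
its value has height at most `B` times its size. -/
theorem EvalR.height_le {M : MFT} (hF : M.IsFT) {B : ℕ} (hB : 1 ≤ B) {g0 g1 g2 : Forest}
    {lab : Option Label} {ys : List Forest} :
    ∀ {rh : RHS M.Q} {out : Forest}, EvalR M rh g0 g1 g2 lab ys out → rh.arityOK M.prm 0 →
      (∀ p x o, rh.HasCall p x → Eval M p (x.sel g0 g1 g2) [] o → o.height ≤ B) →
      out.height ≤ rh.size * B
  | .eps, _, .eps _ _ _ _ _, _, _ => by simp [Forest.height]
  | .node _ c r, _, .node _ _ _ _ _ _ _ _ oc orr hc hr, ha, hcall => by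
    have h1 := EvalR.height_le hF hB hc ha.1 fun p x o h => hcall p x o h.node_left
    have h2 := EvalR.height_le hF hB hr ha.2 fun p x o h => hcall p x o h.node_right
    rw [Forest.height, RHS.size, add_mul, add_mul]
    omega
  | .tnode c r, _, .tnode _ _ _ _ _ _ _ oc orr hc hr, ha, hcall => by
    have h1 := EvalR.height_le hF hB hc ha.1 fun p x o h => hcall p x o h.tnode_left
    have h2 := EvalR.height_le hF hB hr ha.2 fun p x o h => hcall p x o h.tnode_right
    rw [Forest.height, RHS.size, add_mul, add_mul]
    omega
  | .param _ _, _, _, ha, _ => absurd ha.1 (Nat.not_lt_zero _)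
  | .call p x args r, _, .call _ _ _ _ _ _ _ _ _ vs oq orr hL hq hr, ha, hcall => by
    have h1 := EvalR.height_le hF hB hr ha.2.2 fun p x o h => hcall p x o h.call_right
    obtain rfl : args = [] := List.length_eq_zero_iff.mp (ha.1.trans (hF p))
    cases hL
    have h2 := hcall p x oq .call_self hq
    have h3 := Forest.height_append_le oq orr
    rw [RHS.size, add_mul, add_mul]
    omega

/-- An acyclic relation on a finite type is ranked by natural numbers below the cardinality. -/
theorem exists_rank_of_wellFounded {α : Type*} [Fintype α] {R : α → α → Prop}
    (hR : WellFounded R) :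
    ∃ d : α → ℕ, (∀ a, d a < Fintype.card α) ∧ ∀ a b, R a b → d a < d b := by
  classical
  have irr : ∀ a, ¬ Relation.TransGen R a a := fun a h => hR.transGen.irrefl.irrefl a h
  refine ⟨fun a => (Finset.univ.filter fun b => Relation.TransGen R b a).card, fun a => ?_,
    fun a b hab => ?_⟩
  · exact Finset.card_lt_univ_of_notMem (x := a) (by simpa using irr a)
  · refine Finset.card_lt_card (Finset.ssubset_iff_of_subset (fun c hc => ?_) |>.mpr
      ⟨a, by simpa using .single hab, by simpa using irr a⟩)
    simp only [Finset.mem_filter, Finset.mem_univ, true_and] at hc ⊢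
    exact hc.tail hab

/-- If all non-stay calls on input `f` yield outputs of height at most `B`, then stay moves
increase this bound by at most the factor `M.size ^ Fintype.card M.Q`. -/
theorem Eval.height_le_of_moves {M : MFT} (hW : M.WF) (hT : M.Terminating) (hF : M.IsFT)
    {f : Forest} {B : ℕ} (hB : 1 ≤ B)
    (hmove : ∀ q p x o, (M.body q f).HasCall p x → x ≠ .x0 →
      Eval M p (x.sel f f.children f.next) [] o → o.height ≤ B)
    {q : M.Q} {out : Forest} (h : Eval M q f [] out) :
    out.height ≤ M.size ^ Fintype.card M.Q * B := by
  have hK : 1 ≤ M.size := by have := M.two_le_size; omega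
  obtain ⟨d, hd, hlt⟩ := exists_rank_of_wellFounded (R := M.Stay f)
    ⟨fun q => (hT q f []).exists.elim fun _ h => h.acc_stay⟩
  have key : ∀ n q out, d q < n → Eval M q f [] out → out.height ≤ M.size ^ n * B := by
    intro n
    induction n with
    | zero => intro q out hq; omega
    | succ n ih =>
      intro q out hq h
      obtain ⟨lab, hb⟩ := h.exists_evalR_body
      have hB' : B ≤ M.size ^ n * B := Nat.le_mul_of_pos_left _ (Nat.pow_pos hK)
      have := hb.height_le hF (hB.trans hB') (M.body_arityOK hW hF q f) fun p x o hc ho => by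
        by_cases hx : x = .x0
        · subst hx
          have := hlt p q hc
          exact ih p o (by omega) ho
        · exact (hmove q p x o hc hx ho).trans hB'
      calc out.height ≤ (M.body q f).size * (M.size ^ n * B) := this
        _ ≤ M.size * (M.size ^ n * B) := Nat.mul_le_mul_right _ (M.body_size_le hW q f)
        _ = M.size ^ (n + 1) * B := by ring
  exact key _ q out (hd q) h

theorem Eval.height_le {M : MFT} (hW : M.WF) (hT : M.Terminating) (hF : M.IsFT) (f : Forest) :
    ∀ {q : M.Q} {out : Forest}, Eval M q f [] out →
      out.height ≤ (M.size ^ Fintype.card M.Q) ^ (f.height + 1) := by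
  have hc : 0 < M.size ^ Fintype.card M.Q :=
    Nat.pow_pos (by have := M.two_le_size; omega)
  induction f with
  | eps =>
    intro q out h
    have := h.height_le_of_moves (f := .eps) hW hT hF le_rfl fun q p x o hcall hx _ =>
      absurd (hcall.eq_x0 (hW.2.2.2.1 q).2.1) hx
    simpa [Forest.height] using this
  | node l c r ihc ihr =>
    intro q out h
    rw [pow_succ']
    refine h.height_le_of_moves hW hT hF (Nat.pow_pos hc) fun q p x o hcall hx ho => ?_
    cases x with
    | x0 => exact absurd rfl hx
    | x1 => exact (ihc ho).trans (Nat.pow_le_pow_right hc (by simp only [Forest.height]; omega))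
    | x2 => exact (ihr ho).trans (Nat.pow_le_pow_right hc (by simp only [Forest.height]; omega))

/-- Exponential height increase of forest transducers: for
every FT `M` there is a constant `c ≥ 2` such that for every pair
`(f,g) ∈ ⟦M⟧`, the height of the binary tree `fcns(g)` is at most `c^(h+1)`
where `h` is the height of the binary tree `fcns(f)`. -/
theorem ft_height_exponential :
    ∀ M : MFT, M.WF → M.Terminating → M.IsFT →
      ∃ c : ℕ, 2 ≤ c ∧ ∀ f g : Forest, M.Sem f g →
        (fcns g).height ≤ c ^ ((fcns f).height + 1) := by
  intro M hW hT hF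
  have : Nonempty M.Q := ⟨M.q0⟩
  refine ⟨M.size ^ Fintype.card M.Q,
    M.two_le_size.trans (Nat.le_self_pow Fintype.card_ne_zero _), fun f g h => ?_⟩
  rw [fcns_eq_self, fcns_eq_self]
  exact Eval.height_le hW hT hF f h
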